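/- arXiv:1808.04945 — 7 statements merged into one kernel-verified Lean document; each statement's English description precedes it below -/
import Mathlib

section
/- Let (Ω, 𝓕, P) be a probability space, X : Ω → {0,1} a measurable binary exposure, U : Ω → ℝ a random variable, and Y(1) : Ω → ℝ an integrable potential outcome. Assume: (i) latent ignorability: Y(1) and X are conditionally independent given the σ-algebra σ(U) generated by U; (ii) consistency: the observed outcome Y satisfies Y·1{X=1} = Y(1)·1{X=1} almost surely; (iii) positivity: the conditional probability e := P(X=1 | σ(U)) = E[1{X=1} | σ(U)] satisfies e > 0 almost surely, and Y·1{X=1}/e is integrable. Then E[Y(1)] = E[ Y·1{X=1} / e ]. -/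
open MeasureTheory ProbabilityTheory

lemma ipw_aux {Ω : Type*} {m mΩ : MeasurableSpace Ω} [StandardBorelSpace Ω]
    (μ : Measure Ω) [IsFiniteMeasure μ] (hm : m ≤ mΩ)
    (g : Ω → ENNReal) (hg : Measurable[m] g) (S : Set Ω) (hS : MeasurableSet S) :
    ∫⁻ ω, g ω * S.indicator 1 ω ∂μ = ∫⁻ ω, g ω * condExpKernel μ m ω S ∂μ := by
  have hk : Measurable[m] fun ω => condExpKernel μ m ω S := measurable_condExpKernel hS
  have hF : Measurable[m.prod mΩ] (fun p : Ω × Ω => g p.1 * S.indicator (1 : Ω → ENNReal) p.2) :=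
    Measurable.mul (hg.comp (@measurable_fst Ω Ω m mΩ))
      ((measurable_one.indicator hS).comp (@measurable_snd Ω Ω m mΩ))
  have hd : @Measurable Ω (Ω × Ω) mΩ (m.prod mΩ) Function.diag :=
    (measurable_id'' hm).prodMk measurable_id
  have h1 : ∫⁻ p, g p.1 * S.indicator 1 p.2 ∂((μ.trim hm) ⊗ₘ condExpKernel μ m)
      = ∫⁻ ω, g ω * S.indicator 1 ω ∂μ := by
    rw [compProd_trim_condExpKernel hm, @lintegral_map Ω (Ω × Ω) mΩ (m.prod mΩ) _ _ _ hF hd]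
    rfl
  rw [← h1, Measure.lintegral_compProd hF]
  refine Eq.trans ?_ (lintegral_trim hm (hg.mul hk))
  refine lintegral_congr fun ω => ?_
  dsimp only
  rw [lintegral_const_mul _ (measurable_one.indicator hS), lintegral_indicator_one hS]

lemma ipw_general {Ω : Type*} {m mΩ : MeasurableSpace Ω} [StandardBorelSpace Ω]
    (μ : Measure Ω) [IsProbabilityMeasure μ] (hm : m ≤ mΩ)
    (X : Ω → ℝ) (hX : Measurable X)
    (Y Y1 : Ω → ℝ) (hY1int : Integrable Y1 μ)
    (hignor : CondIndepFun m hm Y1 X μ)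
    (B : Set Ω) (hBdef : B = {ω | X ω = 1})
    (hcons : (fun ω => Y ω * B.indicator (fun _ => (1 : ℝ)) ω)
        =ᵐ[μ] fun ω => Y1 ω * B.indicator (fun _ => (1 : ℝ)) ω)
    (e : Ω → ℝ)
    (he : e = μ[B.indicator (fun _ => (1 : ℝ)) | m])
    (hepos : ∀ᵐ ω ∂μ, 0 < e ω) :
    ∫ ω, Y1 ω ∂μ
      = ∫ ω, Y ω * B.indicator (fun _ => (1 : ℝ)) ω / e ω ∂μ := by
  have hB : MeasurableSet B := by
    rw [hBdef]; exact hX (measurableSet_singleton 1)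
  have hem : Measurable[m] e := by
    rw [he]; exact stronglyMeasurable_condExp.measurable
  have hg : Measurable[m] (fun ω => (ENNReal.ofReal (e ω))⁻¹) := hem.ennreal_ofReal.inv
  have heB : ∀ᵐ ω ∂μ, condExpKernel μ m ω B = ENNReal.ofReal (e ω) := by
    have h := condExpKernel_ae_eq_condExp (μ := μ) hm hB
    filter_upwards [h] with ω hω
    rw [he, ← hω, measureReal_def, ENNReal.ofReal_toReal (measure_ne_top _ _)]
  obtain ⟨Z, hZm, hZ⟩ := hY1int.aestronglyMeasurable.aemeasurable
  have hind : Kernel.IndepFun Z X (condExpKernel μ m) (μ.trim hm) := by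
    refine Kernel.IndepFun.congr' hignor ?_ (Filter.Eventually.of_forall fun _ => Filter.EventuallyEq.rfl)
    refine Measure.ae_ae_of_ae_comp ?_
    rw [condExpKernel_comp_trim hm]
    exact hZ
  let d : Ω → ENNReal := fun ω => (ENNReal.ofReal (e ω))⁻¹ * B.indicator 1 ω
  have hd : Measurable d := (hg.mono hm le_rfl).mul (measurable_one.indicator hB)
  have hdtop : ∀ᵐ ω ∂μ, d ω < ⊤ := by
    filter_upwards [hepos] with ω hω
    refine ENNReal.mul_lt_top (by simpa using hω) ?_
    by_cases h : ω ∈ B <;> simp [h]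
  have hmap : (μ.withDensity d).map Z = μ.map Z := by
    ext s hs
    have hA : MeasurableSet (Z ⁻¹' s) := hZm hs
    rw [Measure.map_apply hZm hs, Measure.map_apply hZm hs, withDensity_apply _ hA,
      ← lintegral_indicator hA]
    have h1 : ∀ ω, (Z ⁻¹' s).indicator d ω
        = (ENNReal.ofReal (e ω))⁻¹ * (Z ⁻¹' s ∩ B).indicator 1 ω := by
      intro ω
      by_cases h : ω ∈ Z ⁻¹' s <;> by_cases h' : ω ∈ B <;> simp [d, Set.indicator, h, h']
    simp_rw [h1]
    rw [ipw_aux μ hm _ hg _ (hA.inter hB)]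
    have h2 := ipw_aux μ hm (fun _ => 1) measurable_const _ hA
    simp only [one_mul] at h2
    rw [lintegral_indicator_one hA] at h2
    rw [h2]
    refine lintegral_congr_ae ?_
    have h3 := ae_of_ae_trim hm (hind.meas_inter (s := Z ⁻¹' s) (t := B) ⟨s, hs, rfl⟩
      ⟨{1}, measurableSet_singleton 1, hBdef.symm⟩)
    filter_upwards [h3, heB, hepos] with ω h3 h4 h5
    rw [h3, h4, mul_comm, mul_assoc, ENNReal.mul_inv_cancel (by simpa using h5) (by simp), mul_one]
  calc ∫ ω, Y1 ω ∂μ = ∫ ω, Z ω ∂μ := integral_congr_ae hZ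
    _ = ∫ x, x ∂(μ.map Z) :=
        (integral_map hZm.aemeasurable aestronglyMeasurable_id).symm
    _ = ∫ x, x ∂((μ.withDensity d).map Z) := by rw [hmap]
    _ = ∫ ω, Z ω ∂(μ.withDensity d) := integral_map hZm.aemeasurable aestronglyMeasurable_id
    _ = ∫ ω, (d ω).toReal • Z ω ∂μ := integral_withDensity_eq_integral_toReal_smul hd hdtop _
    _ = _ := by
      refine integral_congr_ae ?_
      filter_upwards [hcons, hZ, hepos] with ω h1 h2 h3
      rw [h1, h2]
      by_cases h : ω ∈ B <;> simp [d, h, h3.le, div_eq_inv_mul]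

/-- Inverse probability weighting identity under latent ignorability: if the potential
outcome `Y1 = Y(1)` is conditionally independent of the binary exposure `X` given `σ(U)`,
consistency holds on `{X = 1}`, and the propensity `e = P(X=1 | σ(U))` is a.s. positive,
then `E[Y(1)] = E[Y · 1{X=1} / e]`. -/
theorem ipw_identity
    {Ω : Type*} [mΩ : MeasurableSpace Ω] [StandardBorelSpace Ω] [Nonempty Ω]
    (μ : Measure Ω) [IsProbabilityMeasure μ]
    (X : Ω → ℝ) (hX : Measurable X) (hXbin : ∀ ω, X ω = 0 ∨ X ω = 1)
    (U : Ω → ℝ) (hU : Measurable U)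
    (Y Y1 : Ω → ℝ) (hY1int : Integrable Y1 μ)
    -- (i) latent ignorability: Y(1) ⫫ X | σ(U)
    (hignor : CondIndepFun (MeasurableSpace.comap U inferInstance) hU.comap_le Y1 X μ)
    -- (ii) consistency on {X = 1}
    (hcons : (fun ω => Y ω * ({ω | X ω = 1} : Set Ω).indicator (fun _ => (1 : ℝ)) ω)
        =ᵐ[μ] fun ω => Y1 ω * ({ω | X ω = 1} : Set Ω).indicator (fun _ => (1 : ℝ)) ω)
    -- (iii) positivity of the propensity score e = P(X=1 | σ(U))
    (e : Ω → ℝ)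
    (he : e = μ[({ω | X ω = 1} : Set Ω).indicator (fun _ => (1 : ℝ)) |
        MeasurableSpace.comap U inferInstance])
    (hepos : ∀ᵐ ω ∂μ, 0 < e ω)
    (hipwint : Integrable
        (fun ω => Y ω * ({ω | X ω = 1} : Set Ω).indicator (fun _ => (1 : ℝ)) ω / e ω) μ) :
    ∫ ω, Y1 ω ∂μ
      = ∫ ω, Y ω * ({ω | X ω = 1} : Set Ω).indicator (fun _ => (1 : ℝ)) ω / e ω ∂μ := by
  exact ipw_general μ hU.comap_le X hX Y Y1 hY1int hignor _ rfl hcons e he hepos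
end

section
/- (Proposition 1, binary exposure.) Let (Ω, 𝓕, P) be a probability space, X : Ω → {0,1} a measurable binary exposure, U, W : Ω → ℝ random variables, Y(0), Y(1) : Ω → ℝ integrable potential outcomes, and let the observed outcome be Y = Y(1)·1{X=1} + Y(0)·1{X=0}. Let b : ℝ × {0,1} → ℝ be measurable with b(W,0) and b(W,1) integrable. Assume for each x ∈ {0,1}: (i) latent ignorability: Y(x) and X are conditionally independent given σ(U); (ii) negative control outcome: W and X are conditionally independent given σ(U); (iii) positivity: P(X=x | σ(U)) > 0 almost surely; (iv) confounding bridge: E[(Y − b(W,x))·1{X=x} | σ(U)] = 0 almost surely. Then E[Y(x)] = E[b(W,x)] for each x ∈ {0,1}; in particular the average causal effect satisfies E[Y(1)] − E[Y(0)] = E[b(W,1)] − E[b(W,0)]. -/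
open MeasureTheory ProbabilityTheory

theorem condExp_mul_of_condIndepFun_aux
    {Ω : Type*} (m : MeasurableSpace Ω) {mΩ : MeasurableSpace Ω} [StandardBorelSpace Ω]
    (μ : Measure Ω) [IsProbabilityMeasure μ] (hm : m ≤ mΩ)
    (Z I : Ω → ℝ) (hZ : Integrable Z μ) (hI : Measurable I) (hIint : Integrable I μ)
    (hZI : Integrable (fun ω => Z ω * I ω) μ)
    (h : CondIndepFun m hm Z I μ) :
    μ[fun ω => Z ω * I ω | m] =ᵐ[μ] fun ω => (μ[Z | m]) ω * (μ[I | m]) ω := by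
  have hmk := aestronglyMeasurable_trim_condExpKernel hm hZ.1
  have hZ'm : Measurable (hZ.1.mk Z) := hZ.1.stronglyMeasurable_mk.measurable
  have h' : CondIndepFun m hm (hZ.1.mk Z) I μ :=
    Kernel.IndepFun.congr' h hmk (Filter.Eventually.of_forall fun _ => Filter.EventuallyEq.rfl)
  rw [condIndepFun_iff_map_prod_eq_prod_map_map hZ'm hI] at h'
  filter_upwards [condExp_ae_eq_integral_condExpKernel hm hZI,
    condExp_ae_eq_integral_condExpKernel hm hZ,
    condExp_ae_eq_integral_condExpKernel hm hIint,
    ae_of_ae_trim hm h', ae_of_ae_trim hm hmk] with ω h1 h2 h3 h4 h5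
  rw [h1, h2, h3]
  rw [Kernel.map_apply _ (hZ'm.prodMk hI), Kernel.prod_apply, Kernel.map_apply _ hZ'm,
    Kernel.map_apply _ hI] at h4
  have hi : IndepFun (hZ.1.mk Z) I (condExpKernel μ m ω) :=
    (indepFun_iff_map_prod_eq_prod_map_map hZ'm.aemeasurable hI.aemeasurable).2 h4
  have hi2 : IndepFun Z I (condExpKernel μ m ω) := hi.congr h5.symm Filter.EventuallyEq.rfl
  exact hi2.integral_fun_mul_eq_mul_integral
    ⟨_, hZ.1.stronglyMeasurable_mk, h5⟩ hI.aestronglyMeasurable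

theorem bridge_aux
    {Ω : Type*} (m : MeasurableSpace Ω) {mΩ : MeasurableSpace Ω} [StandardBorelSpace Ω]
    (μ : Measure Ω) [IsProbabilityMeasure μ] (hm : m ≤ mΩ)
    (X V B : Ω → ℝ) (hX : Measurable X) (hV : Integrable V μ) (hB : Integrable B μ) (x : ℝ)
    (hVX : CondIndepFun m hm V X μ) (hBX : CondIndepFun m hm B X μ)
    (hpos : ∀ᵐ ω ∂μ, 0 < (μ[({ω | X ω = x} : Set Ω).indicator (fun _ => (1 : ℝ)) | m]) ω)
    (hbr : μ[fun ω => (V ω - B ω) * ({ω | X ω = x} : Set Ω).indicator (fun _ => (1 : ℝ)) ω | m]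
      =ᵐ[μ] 0) : ∫ ω, V ω ∂μ = ∫ ω, B ω ∂μ := by
  have hs : MeasurableSet {ω | X ω = x} := hX (measurableSet_singleton x)
  set I : Ω → ℝ := ({ω | X ω = x} : Set Ω).indicator (fun _ => (1 : ℝ)) with hIdef
  have hIm : Measurable I := measurable_const.indicator hs
  have hIint : Integrable I μ := (integrable_const 1).indicator hs
  have hφ : Measurable (({x} : Set ℝ).indicator (fun _ => (1 : ℝ))) :=
    measurable_const.indicator (measurableSet_singleton x)
  have hmul : ∀ Z : Ω → ℝ, Integrable Z μ → Integrable (fun ω => Z ω * I ω) μ := by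
    intro Z hZ
    have : (fun ω => Z ω * I ω) = ({ω | X ω = x} : Set Ω).indicator Z := by
      ext ω
      by_cases h : X ω = x <;> simp [hIdef, Set.indicator, h]
    rw [this]
    exact hZ.indicator hs
  have hci : ∀ Z : Ω → ℝ, CondIndepFun m hm Z X μ → CondIndepFun m hm Z I μ :=
    fun Z h => CondIndepFun.comp h measurable_id hφ
  have e1 := condExp_mul_of_condIndepFun_aux m μ hm V I hV hIm hIint (hmul V hV) (hci V hVX)
  have e2 := condExp_mul_of_condIndepFun_aux m μ hm B I hB hIm hIint (hmul B hB) (hci B hBX)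
  have e3 := condExp_sub (hmul V hV) (hmul B hB) m
  have e4 : (fun ω => (V ω - B ω) * I ω) = (fun ω => V ω * I ω) - (fun ω => B ω * I ω) := by
    ext ω; simp [sub_mul]
  rw [e4] at hbr
  rw [← integral_condExp hm (f := V), ← integral_condExp hm (f := B)]
  apply integral_congr_ae
  filter_upwards [e1, e2, e3, hbr, hpos] with ω h1 h2 h3 h4 h5
  rw [h4] at h3
  simp only [Pi.sub_apply, Pi.zero_apply] at h3
  rw [h1, h2, ← sub_mul] at h3
  rcases mul_eq_zero.1 h3.symm with h | h
  · linarith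
  · exact absurd h h5.ne'


/-- Proposition 1 (binary exposure): under latent ignorability, the negative control
outcome condition, positivity, and the confounding bridge condition, the potential
outcome means are identified by `E[Y(x)] = E[b(W,x)]` for `x ∈ {0,1}`, and hence the
average causal effect is `E[b(W,1)] − E[b(W,0)]`. -/
theorem proposition_one_binary
    {Ω : Type*} [mΩ : MeasurableSpace Ω] [StandardBorelSpace Ω] [Nonempty Ω]
    (μ : Measure Ω) [IsProbabilityMeasure μ]
    (X : Ω → ℝ) (hX : Measurable X) (hXbin : ∀ ω, X ω = 0 ∨ X ω = 1)
    (U W : Ω → ℝ) (hU : Measurable U) (hW : Measurable W)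
    (Y0 Y1 : Ω → ℝ) (hY0int : Integrable Y0 μ) (hY1int : Integrable Y1 μ)
    (Y : Ω → ℝ)
    (hYdef : Y = fun ω => Y1 ω * ({ω | X ω = 1} : Set Ω).indicator (fun _ => (1 : ℝ)) ω
        + Y0 ω * ({ω | X ω = 0} : Set Ω).indicator (fun _ => (1 : ℝ)) ω)
    (b : ℝ → ℝ → ℝ) (hb : Measurable (Function.uncurry b))
    (hb0int : Integrable (fun ω => b (W ω) 0) μ)
    (hb1int : Integrable (fun ω => b (W ω) 1) μ)
    -- (i) latent ignorability: Y(x) ⫫ X | σ(U) for x = 0, 1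
    (hignor0 : CondIndepFun (MeasurableSpace.comap U inferInstance) hU.comap_le Y0 X μ)
    (hignor1 : CondIndepFun (MeasurableSpace.comap U inferInstance) hU.comap_le Y1 X μ)
    -- (ii) negative control outcome: W ⫫ X | σ(U)
    (hnco : CondIndepFun (MeasurableSpace.comap U inferInstance) hU.comap_le W X μ)
    -- (iii) positivity: P(X = x | σ(U)) > 0 a.s. for x = 0, 1
    (hpos : ∀ x ∈ ({0, 1} : Set ℝ),
        ∀ᵐ ω ∂μ, 0 < (μ[({ω | X ω = x} : Set Ω).indicator (fun _ => (1 : ℝ)) |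
          MeasurableSpace.comap U inferInstance]) ω)
    -- (iv) confounding bridge: E[(Y − b(W,x)) · 1{X = x} | σ(U)] = 0 a.s. for x = 0, 1
    (hbridge : ∀ x ∈ ({0, 1} : Set ℝ),
        μ[fun ω => (Y ω - b (W ω) x) * ({ω | X ω = x} : Set Ω).indicator (fun _ => (1 : ℝ)) ω |
          MeasurableSpace.comap U inferInstance] =ᵐ[μ] 0) :
    (∫ ω, Y1 ω ∂μ = ∫ ω, b (W ω) 1 ∂μ) ∧ (∫ ω, Y0 ω ∂μ = ∫ ω, b (W ω) 0 ∂μ) ∧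
      (∫ ω, Y1 ω ∂μ) - (∫ ω, Y0 ω ∂μ) = (∫ ω, b (W ω) 1 ∂μ) - (∫ ω, b (W ω) 0 ∂μ) := by
  have hbm : ∀ x : ℝ, Measurable (fun w => b w x) := fun x =>
    hb.comp (measurable_id.prodMk measurable_const)
  have hci : ∀ x : ℝ, CondIndepFun (MeasurableSpace.comap U inferInstance) hU.comap_le
      (fun ω => b (W ω) x) X μ := fun x => CondIndepFun.comp hnco (hbm x) measurable_id
  have A1 : ∫ ω, Y1 ω ∂μ = ∫ ω, b (W ω) 1 ∂μ := by
    refine bridge_aux _ μ hU.comap_le X Y1 _ hX hY1int hb1int 1 hignor1 (hci 1)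
      (hpos 1 (by simp)) ?_
    convert hbridge 1 (by simp) using 3 with ω
    by_cases h : X ω = 1 <;> simp [hYdef, Set.indicator, h]
  have A0 : ∫ ω, Y0 ω ∂μ = ∫ ω, b (W ω) 0 ∂μ := by
    refine bridge_aux _ μ hU.comap_le X Y0 _ hX hY0int hb0int 0 hignor0 (hci 0)
      (hpos 0 (by simp)) ?_
    convert hbridge 0 (by simp) using 3 with ω
    by_cases h : X ω = 0 <;> simp [hYdef, Set.indicator, h]
  exact ⟨A1, A0, by rw [A1, A0]⟩
end

section
/- (Key identity (5) in the proof of Theorems 1 and 2.) Let (Ω, 𝓕, P) be a probability space and let X, Z, U, Y, W be random variables with Y and b(W,X) integrable, where b is a measurable function with B := b(W,X) : Ω → ℝ. Assume: (i) exclusion of the negative control exposure from the outcome: E[Y | σ(U,X,Z)] = E[Y | σ(U,X)] almost surely; (ii) exclusion of the negative control exposure from the control outcome: E[B | σ(U,X,Z)] = E[B | σ(U,X)] almost surely; (iii) confounding bridge: E[Y | σ(U,X)] = E[B | σ(U,X)] almost surely. Then E[Y | σ(Z,X)] = E[B | σ(Z,X)] almost surely. -/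
open MeasureTheory ProbabilityTheory

/-- Key identity (5) in the proof of Theorems 1 and 2: under exclusion of the negative
control exposure `Z` from the outcome `Y` and the control outcome `B = b(W,X)`, and the
confounding bridge condition, the conditional means of `Y` and `B` given `σ(Z,X)` agree. -/
theorem key_identity_double_negative_control
    {Ω : Type*} [mΩ : MeasurableSpace Ω] (μ : Measure Ω) [IsProbabilityMeasure μ]
    (X Z U Y W : Ω → ℝ) (b : ℝ → ℝ → ℝ)
    (hX : Measurable X) (hZ : Measurable Z) (hU : Measurable U)
    (hW : Measurable W) (hb : Measurable (Function.uncurry b))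
    (B : Ω → ℝ) (hB : B = fun ω => b (W ω) (X ω))
    (hYint : Integrable Y μ) (hBint : Integrable B μ)
    -- (i) exclusion of Z from the outcome Y
    (hexclY : μ[Y | MeasurableSpace.comap (fun ω => (U ω, X ω, Z ω)) inferInstance]
        =ᵐ[μ] μ[Y | MeasurableSpace.comap (fun ω => (U ω, X ω)) inferInstance])
    -- (ii) exclusion of Z from the control outcome B
    (hexclB : μ[B | MeasurableSpace.comap (fun ω => (U ω, X ω, Z ω)) inferInstance]
        =ᵐ[μ] μ[B | MeasurableSpace.comap (fun ω => (U ω, X ω)) inferInstance])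
    -- (iii) confounding bridge
    (hbridge : μ[Y | MeasurableSpace.comap (fun ω => (U ω, X ω)) inferInstance]
        =ᵐ[μ] μ[B | MeasurableSpace.comap (fun ω => (U ω, X ω)) inferInstance]) :
    μ[Y | MeasurableSpace.comap (fun ω => (Z ω, X ω)) inferInstance]
      =ᵐ[μ] μ[B | MeasurableSpace.comap (fun ω => (Z ω, X ω)) inferInstance] := by
  have h3 : MeasurableSpace.comap (fun ω => (U ω, X ω, Z ω)) inferInstance ≤ mΩ :=
    (hU.prodMk (hX.prodMk hZ)).comap_le
  have h2 : MeasurableSpace.comap (fun ω => (Z ω, X ω)) inferInstance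
      ≤ MeasurableSpace.comap (fun ω => (U ω, X ω, Z ω)) inferInstance := by
    have hg : Measurable (fun p : ℝ × ℝ × ℝ => (p.2.2, p.2.1)) := by fun_prop
    rintro s ⟨t, ht, rfl⟩
    exact ⟨_, hg ht, rfl⟩
  have hYB := (hexclY.trans hbridge).trans hexclB.symm
  exact (condExp_condExp_of_le h2 h3).symm.trans
    ((condExp_congr_ae hYB).trans (condExp_condExp_of_le h2 h3))
end

section
/- (Proposition 2, binary exposure: positive control outcome.) Let (Ω, 𝓕, P) be a probability space, X : Ω → {0,1} a measurable binary exposure, U : Ω → ℝ a random variable, Y(0), Y(1) integrable potential outcomes with observed outcome Y = Y(1)·1{X=1} + Y(0)·1{X=0}, and W(0), W(1) potential control outcomes with observed control outcome W = W(1)·1{X=1} + W(0)·1{X=0}. Let b : ℝ × {0,1} → ℝ be measurable with b(W,x) and b(W(x),x) integrable for x ∈ {0,1}. Assume for each x ∈ {0,1}: (i) latent ignorability: Y(x) and X are conditionally independent given σ(U); (ii) positive control: W(x) and X are conditionally independent given σ(U); (iii) positivity: P(X=x | σ(U)) > 0 almost surely; (iv) confounding bridge: E[(Y − b(W,x))·1{X=x}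 | σ(U)] = 0 almost surely. Then E[Y(x)] = E[b(W(x),x)] for each x ∈ {0,1}. -/
open MeasureTheory ProbabilityTheory

lemma key_aux {Ω : Type*} (m : MeasurableSpace Ω) [mΩ : MeasurableSpace Ω] [StandardBorelSpace Ω] [Nonempty Ω]
    (μ : Measure Ω) [IsProbabilityMeasure μ] (hm : m ≤ mΩ)
    (X f : Ω → ℝ) (hX : Measurable X) (hf : Integrable f μ)
    (h : CondIndepFun m hm f X μ) (x : ℝ) :
    μ[fun ω => f ω * ({ω | X ω = x} : Set Ω).indicator (fun _ => (1 : ℝ)) ω | m] =ᵐ[μ]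
      fun ω => (μ[f | m]) ω * (μ[({ω | X ω = x} : Set Ω).indicator (fun _ => (1 : ℝ)) | m]) ω := by
  have hA : MeasurableSet {ω | X ω = x} := hX (measurableSet_singleton x)
  set A : Set Ω := {ω | X ω = x} with hAdef
  have hfA : (fun ω => f ω * A.indicator (fun _ => (1 : ℝ)) ω) = A.indicator f := by
    ext ω
    by_cases hω : ω ∈ A <;> simp [hω]
  rw [hfA]
  obtain ⟨g, hg, hfg⟩ := hf.aestronglyMeasurable
  have hgm : Measurable g := hg.measurable
  have hfg' : ∀ᵐ ω ∂(μ.trim hm), f =ᵐ[condExpKernel μ m ω] g := by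
    refine Measure.ae_ae_of_ae_comp ?_
    rw [condExpKernel_comp_trim]
    exact hfg
  have h0 : Kernel.IndepFun f X (condExpKernel μ m) (μ.trim hm) := h
  rw [Kernel.indepFun_iff_measure_inter_preimage_eq_mul] at h0
  have hXA : X ⁻¹' {x} = A := rfl
  clear_value A
  have h1 : ∀ᵐ ω ∂(μ.trim hm), ∀ q : ℚ,
      condExpKernel μ m ω (f ⁻¹' Set.Iic (q : ℝ) ∩ A)
        = condExpKernel μ m ω (f ⁻¹' Set.Iic (q : ℝ)) * condExpKernel μ m ω A := by
    rw [ae_all_iff]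
    intro q
    have h2 := h0 (Set.Iic (q : ℝ)) {x} measurableSet_Iic (measurableSet_singleton x)
    rw [hXA] at h2
    exact h2
  have e1 := condExp_ae_eq_integral_condExpKernel hm hf
  have e2 := condExp_ae_eq_integral_condExpKernel hm (hf.indicator hA)
  have e3 := condExp_ae_eq_integral_condExpKernel hm
    ((integrable_const (1 : ℝ) (μ := μ)).indicator hA)
  filter_upwards [ae_of_ae_trim hm hfg', ae_of_ae_trim hm h1, e1, e2, e3] with ω k1 k2 k3 k4 k5
  rw [k3, k4, k5]
  set ν := condExpKernel μ m ω with hν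
  have hmap : (ν.restrict A).map g = ν A • ν.map g := by
    refine ext_of_generate_finite (⋃ a : ℚ, {Set.Iic (a : ℝ)}) 
      (Real.borel_eq_generateFrom_Iic_rat ▸ (BorelSpace.measurable_eq (α := ℝ)))
      Real.isPiSystem_Iic_rat ?_ ?_
    · intro s hs
      simp only [Set.mem_iUnion, Set.mem_singleton_iff] at hs
      obtain ⟨q, rfl⟩ := hs
      have hs := hgm (measurableSet_Iic (a := (q : ℝ)))
      rw [Measure.smul_apply, Measure.map_apply hgm measurableSet_Iic,
        Measure.map_apply hgm measurableSet_Iic, Measure.restrict_apply hs, smul_eq_mul, mul_comm]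
      have a1 : ν (g ⁻¹' Set.Iic (q : ℝ)) = ν (f ⁻¹' Set.Iic (q : ℝ)) := by
        refine measure_congr ?_
        filter_upwards [k1] with a ha
        exact congrArg (fun z => z ≤ (q : ℝ)) ha.symm
      have a2 : ν (g ⁻¹' Set.Iic (q : ℝ) ∩ A) = ν (f ⁻¹' Set.Iic (q : ℝ) ∩ A) := by
        refine measure_congr ?_
        filter_upwards [k1] with a ha
        exact congrArg (fun z => z ≤ (q : ℝ) ∧ a ∈ A) ha.symm
      rw [a1, a2, k2 q]
    · simp [Measure.map_apply hgm MeasurableSet.univ]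
  have i1 : ∫ y, f y ∂ν = ∫ y, g y ∂ν := integral_congr_ae k1
  have i2 : ∫ y, A.indicator f y ∂ν = ∫ y in A, g y ∂ν := by
    rw [integral_indicator hA]
    exact integral_congr_ae (ae_restrict_of_ae k1)
  have i3 : ∫ y in A, g y ∂ν = (ν A).toReal * ∫ y, g y ∂ν := by
    have := congrArg (fun ρ : Measure ℝ => ∫ z, z ∂ρ) hmap
    simp only [integral_smul_measure] at this
    rw [integral_map hgm.aemeasurable (by fun_prop),
      integral_map hgm.aemeasurable (by fun_prop)] at this
    simpa using this
  rw [i1, i2, i3, integral_indicator hA]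
  simp [Measure.real, mul_comm]

lemma key_arm {Ω : Type*} (m : MeasurableSpace Ω) [mΩ : MeasurableSpace Ω] [StandardBorelSpace Ω] [Nonempty Ω]
    (μ : Measure Ω) [IsProbabilityMeasure μ] (hm : m ≤ mΩ)
    (X f g : Ω → ℝ) (hX : Measurable X) (hf : Integrable f μ) (hg : Integrable g μ)
    (h : CondIndepFun m hm f X μ) (h' : CondIndepFun m hm g X μ) (x : ℝ)
    (hpos : ∀ᵐ ω ∂μ, 0 < (μ[({ω | X ω = x} : Set Ω).indicator (fun _ => (1 : ℝ)) | m]) ω)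
    (hbr : μ[fun ω => (f ω - g ω) * ({ω | X ω = x} : Set Ω).indicator (fun _ => (1 : ℝ)) ω | m]
      =ᵐ[μ] 0) : ∫ ω, f ω ∂μ = ∫ ω, g ω ∂μ := by
  have hA : MeasurableSet {ω | X ω = x} := hX (measurableSet_singleton x)
  have hi : ∀ k : Ω → ℝ, Integrable k μ → Integrable
      (fun ω => k ω * ({ω | X ω = x} : Set Ω).indicator (fun _ => (1 : ℝ)) ω) μ := by
    intro k hk
    refine (hk.indicator hA).congr (Filter.Eventually.of_forall fun ω => ?_)
    by_cases hω : X ω = x <;> simp [hω]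
  have hs := condExp_sub (hi f hf) (hi g hg) m
  have heq : (fun ω => (f ω - g ω) * ({ω | X ω = x} : Set Ω).indicator (fun _ => (1 : ℝ)) ω)
      = (fun ω => f ω * ({ω | X ω = x} : Set Ω).indicator (fun _ => (1 : ℝ)) ω)
        - (fun ω => g ω * ({ω | X ω = x} : Set Ω).indicator (fun _ => (1 : ℝ)) ω) := by
    ext ω
    simp only [Pi.sub_apply]
    ring
  rw [heq] at hbr
  have hfin : μ[f | m] =ᵐ[μ] μ[g | m] := by
    filter_upwards [hs, hbr, hpos, key_aux m μ hm X f hX hf h x, key_aux m μ hm X g hX hg h' x]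
      with ω a1 a2 a3 a4 a5
    rw [a2, Pi.sub_apply, a4, a5, ← sub_mul] at a1
    have := (mul_eq_zero.1 a1.symm).resolve_right a3.ne'
    linarith
  rw [← integral_condExp hm (f := f), ← integral_condExp hm (f := g)]
  exact integral_congr_ae hfin

/-- Proposition 2 (binary exposure, positive control outcome): under latent ignorability,
the positive control condition `W(x) ⫫ X | σ(U)`, positivity, and the confounding bridge
condition, the potential outcome means are identified by `E[Y(x)] = E[b(W(x),x)]`. -/
theorem proposition_two_positive_control
    {Ω : Type*} [mΩ : MeasurableSpace Ω] [StandardBorelSpace Ω] [Nonempty Ω]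
    (μ : Measure Ω) [IsProbabilityMeasure μ]
    (X : Ω → ℝ) (hX : Measurable X) (hXbin : ∀ ω, X ω = 0 ∨ X ω = 1)
    (U : Ω → ℝ) (hU : Measurable U)
    (Y0 Y1 : Ω → ℝ) (hY0int : Integrable Y0 μ) (hY1int : Integrable Y1 μ)
    (W0 W1 : Ω → ℝ) (hW0 : Measurable W0) (hW1 : Measurable W1)
    (Y W : Ω → ℝ)
    (hYdef : Y = fun ω => Y1 ω * ({ω | X ω = 1} : Set Ω).indicator (fun _ => (1 : ℝ)) ω
        + Y0 ω * ({ω | X ω = 0} : Set Ω).indicator (fun _ => (1 : ℝ)) ω)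
    (hWdef : W = fun ω => W1 ω * ({ω | X ω = 1} : Set Ω).indicator (fun _ => (1 : ℝ)) ω
        + W0 ω * ({ω | X ω = 0} : Set Ω).indicator (fun _ => (1 : ℝ)) ω)
    (b : ℝ → ℝ → ℝ) (hb : Measurable (Function.uncurry b))
    (hbW0int : Integrable (fun ω => b (W ω) 0) μ)
    (hbW1int : Integrable (fun ω => b (W ω) 1) μ)
    (hbW00int : Integrable (fun ω => b (W0 ω) 0) μ)
    (hbW11int : Integrable (fun ω => b (W1 ω) 1) μ)
    -- (i) latent ignorability: Y(x) ⫫ X | σ(U) for x = 0, 1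
    (hignor0 : CondIndepFun (MeasurableSpace.comap U inferInstance) hU.comap_le Y0 X μ)
    (hignor1 : CondIndepFun (MeasurableSpace.comap U inferInstance) hU.comap_le Y1 X μ)
    -- (ii) positive control: W(x) ⫫ X | σ(U) for x = 0, 1
    (hpc0 : CondIndepFun (MeasurableSpace.comap U inferInstance) hU.comap_le W0 X μ)
    (hpc1 : CondIndepFun (MeasurableSpace.comap U inferInstance) hU.comap_le W1 X μ)
    -- (iii) positivity: P(X = x | σ(U)) > 0 a.s. for x = 0, 1
    (hpos : ∀ x ∈ ({0, 1} : Set ℝ),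
        ∀ᵐ ω ∂μ, 0 < (μ[({ω | X ω = x} : Set Ω).indicator (fun _ => (1 : ℝ)) |
          MeasurableSpace.comap U inferInstance]) ω)
    -- (iv) confounding bridge: E[(Y − b(W,x)) · 1{X = x} | σ(U)] = 0 a.s. for x = 0, 1
    (hbridge : ∀ x ∈ ({0, 1} : Set ℝ),
        μ[fun ω => (Y ω - b (W ω) x) * ({ω | X ω = x} : Set Ω).indicator (fun _ => (1 : ℝ)) ω |
          MeasurableSpace.comap U inferInstance] =ᵐ[μ] 0) :
    (∫ ω, Y1 ω ∂μ = ∫ ω, b (W1 ω) 1 ∂μ) ∧ (∫ ω, Y0 ω ∂μ = ∫ ω, b (W0 ω) 0 ∂μ) := by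
  have hb0 : ∀ y : ℝ, Measurable fun w => b w y := fun y =>
    hb.comp (measurable_id.prodMk measurable_const)
  constructor
  · refine key_arm _ μ hU.comap_le X Y1 (fun ω => b (W1 ω) 1) hX hY1int hbW11int hignor1
      (hpc1.comp (hb0 1) measurable_id) 1 (hpos 1 (by simp)) ?_
    convert hbridge 1 (by simp) using 3 with ω
    by_cases hω : X ω = 1 <;> simp [hYdef, hWdef, hω]
  · refine key_arm _ μ hU.comap_le X Y0 (fun ω => b (W0 ω) 0) hX hY0int hbW00int hignor0
      (hpc0.comp (hb0 0) measurable_id) 0 (hpos 0 (by simp)) ?_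
    convert hbridge 0 (by simp) using 3 with ω
    by_cases hω : X ω = 0 <;> simp [hYdef, hWdef, hω]
end

section
/- (Equation (6): average causal effect formula under an additive linear confounding bridge.) Let (Ω, 𝓕, P) be a probability space and X, Z : Ω → {0,1} measurable binary random variables with P(X=x, Z=z) > 0 for all x, z ∈ {0,1}. For an integrable random variable A define μ_A(x,z) := E[A·1{X=x, Z=z}] / P(X=x, Z=z). Let Y, W be integrable random variables and γ₀, γ₁, γ₂ real numbers with μ_Y(x,z) = γ₀ + γ₁x + γ₂·μ_W(x,z) for all x, z ∈ {0,1}. Define D_XY := Σ_{z∈{0,1}} (μ_Y(1,z) − μ_Y(0,z))·P(Z=z), D_XW := Σ_{z} (μ_W(1,z) − μ_W(0,z))·P(Z=z), D_ZY := Σ_{x∈{0,1}} (μ_Y(x,1) − μ_Y(x,0))·P(X=x), and D_ZW := Σ_{x} (μ_W(x,1) − μ_W(x,0))·P(X=x). If D_ZW ≠ 0, then γ₁ = D_XY − (D_ZY / D_ZW)·D_XW. -/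
open MeasureTheory ProbabilityTheory

/-- The conditional mean `μ_A(x,z) = E[A·1{X=x, Z=z}] / P(X=x, Z=z)`. -/
noncomputable def cellMean {Ω : Type*} [MeasurableSpace Ω] (μ : Measure Ω)
    (X Z : Ω → ℝ) (A : Ω → ℝ) (x z : ℝ) : ℝ :=
  (∫ ω, A ω * ({ω | X ω = x ∧ Z ω = z} : Set Ω).indicator (fun _ => (1 : ℝ)) ω ∂μ) /
    (μ {ω | X ω = x ∧ Z ω = z}).toReal

/-- Equation (6): under the additive linear confounding bridge
`b(W,X) = γ₀ + γ₁X + γ₂W` with binary exposures `X` and `Z`, the average causal effect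
`γ₁` is identified purely from crude risk differences:
`ACE_XY = E(RD_{XY|Z}) − [E(RD_{ZY|X}) / E(RD_{ZW|X})] · E(RD_{XW|Z})`. -/
theorem ace_formula_additive_bridge
    {Ω : Type*} [mΩ : MeasurableSpace Ω] (μ : Measure Ω) [IsProbabilityMeasure μ]
    (X Z : Ω → ℝ) (hX : Measurable X) (hZ : Measurable Z)
    (hXbin : ∀ ω, X ω = 0 ∨ X ω = 1) (hZbin : ∀ ω, Z ω = 0 ∨ Z ω = 1)
    (hpos : ∀ x ∈ ({0, 1} : Set ℝ), ∀ z ∈ ({0, 1} : Set ℝ),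
        0 < (μ {ω | X ω = x ∧ Z ω = z}).toReal)
    (Y W : Ω → ℝ) (hYint : Integrable Y μ) (hWint : Integrable W μ)
    (γ₀ γ₁ γ₂ : ℝ)
    (hcell : ∀ x ∈ ({0, 1} : Set ℝ), ∀ z ∈ ({0, 1} : Set ℝ),
        cellMean μ X Z Y x z = γ₀ + γ₁ * x + γ₂ * cellMean μ X Z W x z)
    (DXY DXW DZY DZW : ℝ)
    (hDXY : DXY = (cellMean μ X Z Y 1 0 - cellMean μ X Z Y 0 0) * (μ {ω | Z ω = 0}).toReal
        + (cellMean μ X Z Y 1 1 - cellMean μ X Z Y 0 1) * (μ {ω | Z ω = 1}).toReal)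
    (hDXW : DXW = (cellMean μ X Z W 1 0 - cellMean μ X Z W 0 0) * (μ {ω | Z ω = 0}).toReal
        + (cellMean μ X Z W 1 1 - cellMean μ X Z W 0 1) * (μ {ω | Z ω = 1}).toReal)
    (hDZY : DZY = (cellMean μ X Z Y 0 1 - cellMean μ X Z Y 0 0) * (μ {ω | X ω = 0}).toReal
        + (cellMean μ X Z Y 1 1 - cellMean μ X Z Y 1 0) * (μ {ω | X ω = 1}).toReal)
    (hDZW : DZW = (cellMean μ X Z W 0 1 - cellMean μ X Z W 0 0) * (μ {ω | X ω = 0}).toReal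
        + (cellMean μ X Z W 1 1 - cellMean μ X Z W 1 0) * (μ {ω | X ω = 1}).toReal)
    (hne : DZW ≠ 0) :
    γ₁ = DXY - (DZY / DZW) * DXW := by
  have hsum : (μ {ω | Z ω = 0}).toReal + (μ {ω | Z ω = 1}).toReal = 1 := by
    have hc : {ω | Z ω = 1} = {ω | Z ω = 0}ᶜ := by
      ext ω
      rcases hZbin ω with h | h <;> simp [h]
    have hm : MeasurableSet {ω | Z ω = 0} := hZ (measurableSet_singleton 0)
    have h := probReal_add_probReal_compl (μ := μ) hm
    rw [hc]
    exact h
  have h00 := hcell 0 (by simp) 0 (by simp)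
  have h01 := hcell 0 (by simp) 1 (by simp)
  have h10 := hcell 1 (by simp) 0 (by simp)
  have h11 := hcell 1 (by simp) 1 (by simp)
  have hZY : DZY = γ₂ * DZW := by
    rw [hDZY, hDZW, h00, h01, h10, h11]; ring
  have hXY : DXY = γ₁ + γ₂ * DXW := by
    rw [hDXY, hDXW, h00, h01, h10, h11]
    linear_combination γ₁ * hsum
  rw [hZY, hXY, mul_div_assoc, div_self hne]
  ring
end

section
/- (Example 8: average causal effect formula with interaction in the confounding bridge.) Let (Ω, 𝓕, P) be a probability space and X, Z : Ω → {0,1} measurable binary random variables with P(X=x, Z=z) > 0 for all x, z ∈ {0,1}. For an integrable random variable A define μ_A(x,z) := E[A·1{X=x, Z=z}] / P(X=x, Z=z). Let Y, W be integrable random variables and γ₀, γ₁, γ₂, γ₃ real numbers with μ_Y(x,z) = γ₀ + γ₁x + (γ₂+γ₃x)·μ_W(x,z) for all x, z ∈ {0,1}. Then γ₁ + γ₃·E[W] = Σ_{z} (μ_Y(1,z) − μ_Y(0,z))·P(Z=z) − (γ₂+γ₃)·Σ_{z} (μ_W(1,z) − μ_W(0,z))·P(Z=z) + γ₃·Σ_{z}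 (μ_W(1,z) − μ_W(0,z))·P(Z=z, X=1). -/
open MeasureTheory ProbabilityTheory

/-- Example 8 with interaction: under the linear confounding bridge with interaction
`b(W,X) = γ₀ + γ₁X + γ₂W + γ₃XW` and binary exposures `X, Z`, the average causal effect
`γ₁ + γ₃·E[W]` is expressed via the crude risk differences. -/
theorem ace_formula_interaction_bridge
    {Ω : Type*} [mΩ : MeasurableSpace Ω] (μ : Measure Ω) [IsProbabilityMeasure μ]
    (X Z : Ω → ℝ) (hX : Measurable X) (hZ : Measurable Z)
    (hXbin : ∀ ω, X ω = 0 ∨ X ω = 1) (hZbin : ∀ ω, Z ω = 0 ∨ Z ω = 1)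
    (hpos : ∀ x ∈ ({0, 1} : Set ℝ), ∀ z ∈ ({0, 1} : Set ℝ),
        0 < (μ {ω | X ω = x ∧ Z ω = z}).toReal)
    (Y W : Ω → ℝ) (hYint : Integrable Y μ) (hWint : Integrable W μ)
    (γ₀ γ₁ γ₂ γ₃ : ℝ)
    (hcell : ∀ x ∈ ({0, 1} : Set ℝ), ∀ z ∈ ({0, 1} : Set ℝ),
        cellMean μ X Z Y x z = γ₀ + γ₁ * x + (γ₂ + γ₃ * x) * cellMean μ X Z W x z) :
    γ₁ + γ₃ * ∫ ω, W ω ∂μ =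
      ((cellMean μ X Z Y 1 0 - cellMean μ X Z Y 0 0) * (μ {ω | Z ω = 0}).toReal
        + (cellMean μ X Z Y 1 1 - cellMean μ X Z Y 0 1) * (μ {ω | Z ω = 1}).toReal)
      - (γ₂ + γ₃) *
        ((cellMean μ X Z W 1 0 - cellMean μ X Z W 0 0) * (μ {ω | Z ω = 0}).toReal
          + (cellMean μ X Z W 1 1 - cellMean μ X Z W 0 1) * (μ {ω | Z ω = 1}).toReal)
      + γ₃ *
        ((cellMean μ X Z W 1 0 - cellMean μ X Z W 0 0) * (μ {ω | Z ω = 0 ∧ X ω = 1}).toReal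
          + (cellMean μ X Z W 1 1 - cellMean μ X Z W 0 1) * (μ {ω | Z ω = 1 ∧ X ω = 1}).toReal) := by
  have hm : ∀ x z : ℝ, MeasurableSet {ω | X ω = x ∧ Z ω = z} := fun x z =>
    (hX (measurableSet_singleton x)).inter (hZ (measurableSet_singleton z))
  have hI : ∀ x z : ℝ, Integrable
      (fun ω => W ω * ({ω | X ω = x ∧ Z ω = z} : Set Ω).indicator (fun _ => (1 : ℝ)) ω) μ := by
    intro x z
    refine (hWint.indicator (hm x z)).congr (Filter.Eventually.of_forall fun ω => ?_)
    by_cases h : X ω = x ∧ Z ω = z <;> simp [Set.indicator, h]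
  have hW : ∫ ω, W ω ∂μ =
      cellMean μ X Z W 0 0 * (μ {ω | X ω = 0 ∧ Z ω = 0}).toReal
      + cellMean μ X Z W 0 1 * (μ {ω | X ω = 0 ∧ Z ω = 1}).toReal
      + cellMean μ X Z W 1 0 * (μ {ω | X ω = 1 ∧ Z ω = 0}).toReal
      + cellMean μ X Z W 1 1 * (μ {ω | X ω = 1 ∧ Z ω = 1}).toReal := by
    unfold cellMean
    rw [div_mul_cancel₀ _ (hpos 0 (by simp) 0 (by simp)).ne',
      div_mul_cancel₀ _ (hpos 0 (by simp) 1 (by simp)).ne',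
      div_mul_cancel₀ _ (hpos 1 (by simp) 0 (by simp)).ne',
      div_mul_cancel₀ _ (hpos 1 (by simp) 1 (by simp)).ne',
      ← integral_add' (hI 0 0) (hI 0 1),
      ← integral_add' ((hI 0 0).add (hI 0 1)) (hI 1 0),
      ← integral_add' (((hI 0 0).add (hI 0 1)).add (hI 1 0)) (hI 1 1)]
    refine integral_congr_ae (Filter.Eventually.of_forall fun ω => ?_)
    rcases hXbin ω with h | h <;> rcases hZbin ω with h' | h' <;>
      simp [Set.indicator, h, h']
  have hz : ∀ z : ℝ, (μ {ω | Z ω = z}).toReal =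
      (μ {ω | X ω = 0 ∧ Z ω = z}).toReal + (μ {ω | X ω = 1 ∧ Z ω = z}).toReal := by
    intro z
    rw [← ENNReal.toReal_add (measure_ne_top _ _) (measure_ne_top _ _), ← measure_union _ (hm 1 z)]
    · congr 2
      ext ω
      rcases hXbin ω with h | h <;> simp [h]
    · rw [Set.disjoint_left]
      rintro ω ⟨h, _⟩ ⟨h', _⟩
      rw [h] at h'
      exact zero_ne_one h'
  have hone : (μ {ω | Z ω = 0}).toReal + (μ {ω | Z ω = 1}).toReal = 1 := by
    rw [← ENNReal.toReal_add (measure_ne_top _ _) (measure_ne_top _ _),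
      ← measure_union _ (show MeasurableSet {ω | Z ω = 1} from hZ (measurableSet_singleton 1))]
    · have : {ω | Z ω = 0} ∪ {ω | Z ω = 1} = Set.univ := by
        ext ω
        simpa using hZbin ω
      change (μ ({ω | Z ω = 0} ∪ {ω | Z ω = 1})).toReal = 1
      simp [this]
    · rw [Set.disjoint_left]
      intro ω h h'
      have h1 : Z ω = 0 := h
      have h2 : Z ω = 1 := h'
      rw [h1] at h2
      exact zero_ne_one h2
  have hc : ∀ z : ℝ, {ω | Z ω = z ∧ X ω = 1} = {ω | X ω = 1 ∧ Z ω = z} := by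
    intro z
    ext ω
    exact and_comm
  rw [hc, hc, hW, hcell 0 (by simp) 0 (by simp), hcell 0 (by simp) 1 (by simp),
    hcell 1 (by simp) 0 (by simp), hcell 1 (by simp) 1 (by simp)]
  rw [hz 0, hz 1] at hone ⊢
  linear_combination (-γ₁) * hone
end

section
/- (Example 9: average causal effect with a positive control outcome and linear bridge.) Let (Ω, 𝓕, P) be a probability space, X : Ω → {0,1} a measurable binary exposure, U a random variable, Y(0), Y(1) integrable potential outcomes with observed outcome Y = Y(1)·1{X=1} + Y(0)·1{X=0}, and W(0), W(1) integrable potential control outcomes with observed control outcome W = W(1)·1{X=1} + W(0)·1{X=0}. Let γ₀, γ₁, γ₂ be real numbers. Assume for each x ∈ {0,1}: (i) Y(x) and X are conditionally independent given σ(U); (ii) W(x) and X are conditionally independent given σ(U); (iii) P(X=x | σ(U)) > 0 almost surely; (iv) linear confounding bridge: E[(Y − γ₀ − γ₁X − γ₂W)·1{X=x} | σ(U)] = 0 almost surely. Then E[Y(1)] − E[Y(0)] = γ₁ + γ₂·(E[W(1)] − E[W(0)]); that is, ACE_XY = γ₁ + γ₂·ACE_XW. -/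
open MeasureTheory ProbabilityTheory

lemma aux_condExp_mul
    {Ω : Type*} {m : MeasurableSpace Ω} [mΩ : MeasurableSpace Ω] [StandardBorelSpace Ω]
    (μ : Measure Ω) [IsProbabilityMeasure μ] (hm : m ≤ mΩ)
    (X : Ω → ℝ) (hX : Measurable X) (V : Ω → ℝ) (hV : Integrable V μ)
    (h : CondIndepFun m hm V X μ) (x : ℝ) :
    μ[fun ω => V ω * ({ω | X ω = x} : Set Ω).indicator (fun _ => (1 : ℝ)) ω | m] =ᵐ[μ]
      fun ω => (μ[V | m]) ω *
        (μ[({ω | X ω = x} : Set Ω).indicator (fun _ => (1 : ℝ)) | m]) ω := by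
  set A : Set Ω := {ω | X ω = x} with hA
  have hAm : MeasurableSet A := hX (measurableSet_singleton x)
  set I : Ω → ℝ := A.indicator (fun _ => (1 : ℝ)) with hI
  have hIm : Measurable I := measurable_const.indicator hAm
  have hIint : Integrable I μ := (integrable_const (1 : ℝ)).indicator hAm
  have hVI : Integrable (fun ω => V ω * I ω) μ := by
    refine (hV.indicator hAm).congr (Filter.Eventually.of_forall fun ω => ?_)
    by_cases hω : ω ∈ A <;> simp [hI, hω]
  have hmk := aestronglyMeasurable_trim_condExpKernel (m := m) hm hV.1
  set g : Ω → ℝ := hV.1.mk V with hg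
  have hgm : Measurable g := hV.1.stronglyMeasurable_mk.measurable
  have hgX : Kernel.IndepFun g X (condExpKernel μ m) (μ.trim hm) :=
    Kernel.IndepFun.congr' h hmk (Filter.Eventually.of_forall fun a => Filter.EventuallyEq.rfl)
  have hq : ∀ᵐ ω ∂μ, ∀ q : ℚ, condExpKernel μ m ω (g ⁻¹' (Set.Iio (q : ℝ)) ∩ A)
      = condExpKernel μ m ω (g ⁻¹' (Set.Iio (q : ℝ))) * condExpKernel μ m ω A := by
    rw [ae_all_iff]
    intro q
    exact ae_of_ae_trim hm (hgX _ _ ⟨_, measurableSet_Iio, rfl⟩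
      ⟨{x}, measurableSet_singleton x, rfl⟩)
  filter_upwards [hq, ae_of_ae_trim hm hmk, condExp_ae_eq_integral_condExpKernel hm hVI,
    condExp_ae_eq_integral_condExpKernel hm hV,
    condExp_ae_eq_integral_condExpKernel hm hIint] with ω h1 h2 h3 h4 h5
  rw [h3, h4, h5]
  have hind : IndepFun g I (condExpKernel μ m ω) := by
    have hi : Indep (MeasurableSpace.comap g inferInstance) (MeasurableSpace.generateFrom {A})
        (condExpKernel μ m ω) := by
      refine IndepSets.indep (p1 := Set.preimage g '' (⋃ a : ℚ, {Set.Iio (a : ℝ)})) (p2 := {A})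
        hgm.comap_le (MeasurableSpace.generateFrom_le (by simpa using hAm)) ?_
        (IsPiSystem.singleton A) ?_ rfl ?_
      · exact Real.isPiSystem_Iio_rat.comap g
      · rw [← MeasurableSpace.comap_generateFrom, ← Real.borel_eq_generateFrom_Iio_rat,
          BorelSpace.measurable_eq (α := ℝ)]
      · rw [IndepSets_iff]
        rintro _ _ ⟨s, hs, rfl⟩ rfl
        simp only [Set.mem_iUnion, Set.mem_singleton_iff] at hs
        obtain ⟨q, rfl⟩ := hs
        exact h1 q
    rw [IndepFun_iff_Indep]
    refine indep_of_indep_of_le_right hi ?_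
    rw [← measurable_iff_comap_le]
    exact measurable_const.indicator (MeasurableSpace.measurableSet_generateFrom rfl)
  have e1 : ∫ y, V y * I y ∂(condExpKernel μ m ω) = ∫ y, g y * I y ∂(condExpKernel μ m ω) := by
    refine integral_congr_ae ?_
    filter_upwards [h2] with y hy
    rw [hy]
  rw [e1, integral_congr_ae h2]
  exact hind.integral_fun_mul_eq_mul_integral hgm.aestronglyMeasurable hIm.aestronglyMeasurable

lemma aux_arm
    {Ω : Type*} {m : MeasurableSpace Ω} [mΩ : MeasurableSpace Ω] [StandardBorelSpace Ω]
    (μ : Measure Ω) [IsProbabilityMeasure μ] (hm : m ≤ mΩ)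
    (X : Ω → ℝ) (hX : Measurable X) (V Z : Ω → ℝ) (hV : Integrable V μ) (hZ : Integrable Z μ)
    (h : CondIndepFun m hm V X μ) (h' : CondIndepFun m hm Z X μ) (x b c : ℝ)
    (hpos : ∀ᵐ ω ∂μ, 0 < (μ[({ω | X ω = x} : Set Ω).indicator (fun _ => (1 : ℝ)) | m]) ω)
    (hb : μ[fun ω => (V ω - c - b * Z ω) *
            ({ω | X ω = x} : Set Ω).indicator (fun _ => (1 : ℝ)) ω | m] =ᵐ[μ] 0) :
    ∫ ω, V ω ∂μ = c + b * ∫ ω, Z ω ∂μ := by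
  have k1 := aux_condExp_mul μ hm X hX V hV h x
  have k2 := aux_condExp_mul μ hm X hX Z hZ h' x
  set A : Set Ω := {ω | X ω = x} with hA
  have hAm : MeasurableSet A := hX (measurableSet_singleton x)
  set I : Ω → ℝ := A.indicator (fun _ => (1 : ℝ)) with hI
  have hIint : Integrable I μ := (integrable_const (1 : ℝ)).indicator hAm
  have hmul : ∀ V : Ω → ℝ, Integrable V μ → Integrable (fun ω => V ω * I ω) μ := by
    intro V hV
    refine (hV.indicator hAm).congr (Filter.Eventually.of_forall fun ω => ?_)
    by_cases hω : ω ∈ A <;> simp [hI, hω]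
  have e : (fun ω => (V ω - c - b * Z ω) * I ω)
      = ((fun ω => V ω * I ω) - c • I) - b • (fun ω => Z ω * I ω) := by
    funext ω; simp only [Pi.sub_apply, Pi.smul_apply, smul_eq_mul]; ring
  rw [e] at hb
  have hz : μ[V | m] =ᵐ[μ] fun ω => c + b * (μ[Z | m]) ω := by
    filter_upwards [k1, k2, hb, hpos,
      condExp_sub ((hmul V hV).sub (hIint.smul c)) ((hmul Z hZ).smul b) m,
      condExp_sub (hmul V hV) (hIint.smul c) m,
      condExp_smul c I m (μ := μ), condExp_smul b (fun ω => Z ω * I ω) m (μ := μ)]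
      with ω h1 h2 h3 h4 h5 h6 h7 h8
    rw [h5] at h3
    simp only [Pi.sub_apply, Pi.smul_apply, smul_eq_mul, Pi.zero_apply] at h3 h6 h7 h8
    rw [h6, h7, h8, h1, h2] at h3
    have : (μ[I | m]) ω * ((μ[V | m]) ω - (c + b * (μ[Z | m]) ω)) = 0 := by
      linear_combination h3
    rcases mul_eq_zero.1 this with h0 | h0
    · exact absurd h0 h4.ne'
    · linarith
  rw [← integral_condExp hm (f := V), integral_congr_ae hz, integral_add (integrable_const _)
    (integrable_condExp.const_mul b), integral_const_mul, integral_condExp hm]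
  simp

/-- Example 9: average causal effect with a positive control outcome and a linear
confounding bridge `b(W,X) = γ₀ + γ₁X + γ₂W`:
`ACE_XY = E[Y(1)] − E[Y(0)] = γ₁ + γ₂·(E[W(1)] − E[W(0)]) = γ₁ + γ₂·ACE_XW`. -/
theorem ace_positive_control_linear_bridge
    {Ω : Type*} [mΩ : MeasurableSpace Ω] [StandardBorelSpace Ω] [Nonempty Ω]
    (μ : Measure Ω) [IsProbabilityMeasure μ]
    (X : Ω → ℝ) (hX : Measurable X) (hXbin : ∀ ω, X ω = 0 ∨ X ω = 1)
    (U : Ω → ℝ) (hU : Measurable U)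
    (Y0 Y1 : Ω → ℝ) (hY0int : Integrable Y0 μ) (hY1int : Integrable Y1 μ)
    (W0 W1 : Ω → ℝ) (hW0int : Integrable W0 μ) (hW1int : Integrable W1 μ)
    (Y W : Ω → ℝ)
    (hYdef : Y = fun ω => Y1 ω * ({ω | X ω = 1} : Set Ω).indicator (fun _ => (1 : ℝ)) ω
        + Y0 ω * ({ω | X ω = 0} : Set Ω).indicator (fun _ => (1 : ℝ)) ω)
    (hWdef : W = fun ω => W1 ω * ({ω | X ω = 1} : Set Ω).indicator (fun _ => (1 : ℝ)) ω
        + W0 ω * ({ω | X ω = 0} : Set Ω).indicator (fun _ => (1 : ℝ)) ω)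
    (γ₀ γ₁ γ₂ : ℝ)
    -- (i) latent ignorability: Y(x) ⫫ X | σ(U) for x = 0, 1
    (hignor0 : CondIndepFun (MeasurableSpace.comap U inferInstance) hU.comap_le Y0 X μ)
    (hignor1 : CondIndepFun (MeasurableSpace.comap U inferInstance) hU.comap_le Y1 X μ)
    -- (ii) positive control: W(x) ⫫ X | σ(U) for x = 0, 1
    (hpc0 : CondIndepFun (MeasurableSpace.comap U inferInstance) hU.comap_le W0 X μ)
    (hpc1 : CondIndepFun (MeasurableSpace.comap U inferInstance) hU.comap_le W1 X μ)
    -- (iii) positivity: P(X = x | σ(U)) > 0 a.s. for x = 0, 1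
    (hpos : ∀ x ∈ ({0, 1} : Set ℝ),
        ∀ᵐ ω ∂μ, 0 < (μ[({ω | X ω = x} : Set Ω).indicator (fun _ => (1 : ℝ)) |
          MeasurableSpace.comap U inferInstance]) ω)
    -- (iv) linear confounding bridge: E[(Y − γ₀ − γ₁X − γ₂W)·1{X = x} | σ(U)] = 0 a.s.
    (hbridge : ∀ x ∈ ({0, 1} : Set ℝ),
        μ[fun ω => (Y ω - γ₀ - γ₁ * X ω - γ₂ * W ω) *
            ({ω | X ω = x} : Set Ω).indicator (fun _ => (1 : ℝ)) ω |
          MeasurableSpace.comap U inferInstance] =ᵐ[μ] 0) :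
    (∫ ω, Y1 ω ∂μ) - (∫ ω, Y0 ω ∂μ)
      = γ₁ + γ₂ * ((∫ ω, W1 ω ∂μ) - (∫ ω, W0 ω ∂μ)) := by
  have i0 := aux_arm μ hU.comap_le X hX Y0 W0 hY0int hW0int hignor0 hpc0 0 γ₂ γ₀
    (hpos 0 (by simp)) (by
      refine Filter.EventuallyEq.trans (Filter.EventuallyEq.of_eq ?_) (hbridge 0 (by simp))
      congr 1
      funext ω
      by_cases h0 : X ω = 0 <;> simp [hYdef, hWdef, h0])
  have i1 := aux_arm μ hU.comap_le X hX Y1 W1 hY1int hW1int hignor1 hpc1 1 γ₂ (γ₀ + γ₁)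
    (hpos 1 (by simp)) (by
      refine Filter.EventuallyEq.trans (Filter.EventuallyEq.of_eq ?_) (hbridge 1 (by simp))
      congr 1
      funext ω
      by_cases h0 : X ω = 1 <;> simp [hYdef, hWdef, h0]
      ring)
  rw [i0, i1]
  ring
end
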